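/- Submultiplicativity of the stabilizer extent: for all n, m ≥ 1 and all density matrices ρ on ℂ^(2ⁿ) and σ on ℂ^(2ᵐ), the Kronecker product ρ ⊗ σ (a density matrix on ℂ^(2^(n+m)), under the standard identification of Fin(2ⁿ) × Fin(2ᵐ) with Fin(2^(n+m))) satisfies Γ(ρ ⊗ σ) ≤ Γ(ρ)·Γ(σ). -/

import Mathlib

open Matrix Kronecker Finset
open scoped ComplexOrder

noncomputable section

def PX : Matrix (Fin 2) (Fin 2) ℂ := !![0, 1; 1, 0]
def PY : Matrix (Fin 2) (Fin 2) ℂ := !![0, -Complex.I; Complex.I, 0]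
def PZ : Matrix (Fin 2) (Fin 2) ℂ := !![1, 0; 0, -1]

/-- The single-qubit phase-point operator `A_{(q,p)}`. -/
def A1 (a : ZMod 2 × ZMod 2) : Matrix (Fin 2) (Fin 2) ℂ :=
  (1 / 2 : ℂ) • ((1 : Matrix (Fin 2) (Fin 2) ℂ)
    + ((-1 : ℂ) ^ a.2.val) • PX
    + ((-1 : ℂ) ^ (a.1.val + a.2.val)) • PY
    + ((-1 : ℂ) ^ a.1.val) • PZ)

def pauli : Fin 4 → Matrix (Fin 2) (Fin 2) ℂ := ![1, PX, PY, PZ]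

/-- The `n`-qubit phase-point operator `A_α`, a Kronecker product of single-qubit ones. -/
def phasePoint : (n : ℕ) → (Fin n → ZMod 2 × ZMod 2) → Matrix (Fin (2 ^ n)) (Fin (2 ^ n)) ℂ
  | 0, _ => 1
  | n + 1, α =>
      Matrix.reindex (finProdFinEquiv.trans (finCongr (by ring)))
        (finProdFinEquiv.trans (finCongr (by ring)))
        (A1 (α 0) ⊗ₖ phasePoint n fun i => α i.succ)

/-- An `n`-fold Kronecker product of Pauli matrices. -/
def pauliTensor : (n : ℕ) → (Fin n → Fin 4) → Matrix (Fin (2 ^ n)) (Fin (2 ^ n)) ℂ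
  | 0, _ => 1
  | n + 1, f =>
      Matrix.reindex (finProdFinEquiv.trans (finCongr (by ring)))
        (finProdFinEquiv.trans (finCongr (by ring)))
        (pauli (f 0) ⊗ₖ pauliTensor n fun i => f i.succ)

/-- The `n`-qubit Pauli group: phases `i^k` times tensor products of Paulis. -/
def PauliGroup (n : ℕ) : Set (Matrix (Fin (2 ^ n)) (Fin (2 ^ n)) ℂ) :=
  { M | ∃ (k : Fin 4) (f : Fin n → Fin 4), M = Complex.I ^ (k : ℕ) • pauliTensor n f }

/-- `S` is an abelian subgroup of the Pauli group of size `2^n` with `-I ∉ S`. -/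
def IsStabGroup (n : ℕ) (S : Finset (Matrix (Fin (2 ^ n)) (Fin (2 ^ n)) ℂ)) : Prop :=
  (∀ g ∈ S, g ∈ PauliGroup n) ∧
  (1 : Matrix (Fin (2 ^ n)) (Fin (2 ^ n)) ℂ) ∈ S ∧
  (∀ g ∈ S, ∀ h ∈ S, g * h ∈ S ∧ g * h = h * g) ∧
  S.card = 2 ^ n ∧
  (-1 : Matrix (Fin (2 ^ n)) (Fin (2 ^ n)) ℂ) ∉ S

/-- The set of pure `n`-qubit stabilizer states. -/
def Stab (n : ℕ) : Set (Matrix (Fin (2 ^ n)) (Fin (2 ^ n)) ℂ) :=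
  { σ | ∃ S : Finset (Matrix (Fin (2 ^ n)) (Fin (2 ^ n)) ℂ),
      IsStabGroup n S ∧ σ = ((2 : ℂ) ^ n)⁻¹ • ∑ g ∈ S, g }

/-- A density matrix: positive semidefinite with unit trace. -/
def IsDensity {d : ℕ} (ρ : Matrix (Fin d) (Fin d) ℂ) : Prop :=
  ρ.PosSemidef ∧ ρ.trace = 1

/-- The discrete Wigner function `W_ρ(α) = 2^{-n} Tr(ρ A_α)` (real part). -/
def Wig (n : ℕ) (ρ : Matrix (Fin (2 ^ n)) (Fin (2 ^ n)) ℂ)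
    (α : Fin n → ZMod 2 × ZMod 2) : ℝ :=
  (((2 : ℂ) ^ n)⁻¹ * (ρ * phasePoint n α).trace).re

/-- The free Wigner polytope: convex hull of stabilizer Wigner functions. -/
def WFree (n : ℕ) : Set ((Fin n → ZMod 2 × ZMod 2) → ℝ) :=
  convexHull ℝ { w | ∃ σ ∈ Stab n, w = Wig n σ }

/-- The ℓ¹ norm on phase-space functions. -/
def l1 {n : ℕ} (v : (Fin n → ZMod 2 × ZMod 2) → ℝ) : ℝ := ∑ α, |v α|

/-- The Wigner distance `C(ρ)`: ℓ¹ distance from `W_ρ` to the free polytope. -/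
def Cdist (n : ℕ) (ρ : Matrix (Fin (2 ^ n)) (Fin (2 ^ n)) ℂ) : ℝ :=
  sInf { d | ∃ f ∈ WFree n, d = l1 (Wig n ρ - f) }

/-- The stabilizer extent `Γ(ρ)`. -/
def Gam (n : ℕ) (ρ : Matrix (Fin (2 ^ n)) (Fin (2 ^ n)) ℂ) : ℝ :=
  sInf { t | ∃ (k : ℕ) (a : Fin k → ℝ) (s : Fin k → Matrix (Fin (2 ^ n)) (Fin (2 ^ n)) ℂ),
      (∀ i, s i ∈ Stab n) ∧ ρ = ∑ i, a i • s i ∧ t = ∑ i, |a i| }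

/-- Kronecker product with index bookkeeping `Fin (2^n) × Fin (2^m) ≃ Fin (2^(n+m))`. -/
def kron {n m : ℕ} (M : Matrix (Fin (2 ^ n)) (Fin (2 ^ n)) ℂ)
    (N : Matrix (Fin (2 ^ m)) (Fin (2 ^ m)) ℂ) :
    Matrix (Fin (2 ^ (n + m))) (Fin (2 ^ (n + m))) ℂ :=
  Matrix.reindex (finProdFinEquiv.trans (finCongr (pow_add 2 n m).symm))
    (finProdFinEquiv.trans (finCongr (pow_add 2 n m).symm)) (M ⊗ₖ N)

section

variable {n m : ℕ}

/-- The identification of pairs of indices underlying `kron`. -/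
def kronIndex (n m : ℕ) : Fin (2 ^ (n + m)) ≃ Fin (2 ^ n) × Fin (2 ^ m) :=
  (finProdFinEquiv.trans (finCongr (pow_add 2 n m).symm)).symm

theorem kron_apply (M : Matrix (Fin (2 ^ n)) (Fin (2 ^ n)) ℂ)
    (N : Matrix (Fin (2 ^ m)) (Fin (2 ^ m)) ℂ) (i j : Fin (2 ^ (n + m))) :
    kron M N i j = M (kronIndex n m i).1 (kronIndex n m j).1 *
      N (kronIndex n m i).2 (kronIndex n m j).2 := rfl

theorem kronIndex_fst_val (i : Fin (2 ^ (n + m))) :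
    ((kronIndex n m i).1 : ℕ) = i / 2 ^ m := rfl

theorem kronIndex_snd_val (i : Fin (2 ^ (n + m))) :
    ((kronIndex n m i).2 : ℕ) = i % 2 ^ m := rfl

theorem kron_mul_kron (A B : Matrix (Fin (2 ^ n)) (Fin (2 ^ n)) ℂ)
    (C D : Matrix (Fin (2 ^ m)) (Fin (2 ^ m)) ℂ) :
    kron A C * kron B D = kron (A * B) (C * D) := by
  simp only [kron, reindex_apply, submatrix_mul_equiv, mul_kronecker_mul]

theorem one_kron_one :
    kron (1 : Matrix (Fin (2 ^ n)) (Fin (2 ^ n)) ℂ) (1 : Matrix (Fin (2 ^ m)) (Fin (2 ^ m)) ℂ) =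
      1 := by
  simp only [kron, reindex_apply, one_kronecker_one, submatrix_one_equiv]

theorem smul_kron_smul (a b : ℂ) (A : Matrix (Fin (2 ^ n)) (Fin (2 ^ n)) ℂ)
    (B : Matrix (Fin (2 ^ m)) (Fin (2 ^ m)) ℂ) :
    kron (a • A) (b • B) = (a * b) • kron A B := by
  ext i j
  simp only [kron_apply, Matrix.smul_apply, smul_eq_mul]
  ring

/-- `kron` as a real-bilinear map. -/
def kronBilin (n m : ℕ) : Matrix (Fin (2 ^ n)) (Fin (2 ^ n)) ℂ →ₗ[ℝ]
    Matrix (Fin (2 ^ m)) (Fin (2 ^ m)) ℂ →ₗ[ℝ]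
      Matrix (Fin (2 ^ (n + m))) (Fin (2 ^ (n + m))) ℂ :=
  LinearMap.mk₂ ℝ kron
    (fun _ _ _ => by ext i j; simp [kron_apply, add_mul])
    (fun _ _ _ => by ext i j; simp [kron_apply, mul_assoc])
    (fun _ _ _ => by ext i j; simp [kron_apply, mul_add])
    (fun _ _ _ => by ext i j; simp [kron_apply, mul_left_comm])

theorem kronBilin_apply (A : Matrix (Fin (2 ^ n)) (Fin (2 ^ n)) ℂ)
    (B : Matrix (Fin (2 ^ m)) (Fin (2 ^ m)) ℂ) : kronBilin n m A B = kron A B := rfl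

theorem sum_kron_sum {ι κ : Type*} (s : Finset ι) (t : Finset κ)
    (A : ι → Matrix (Fin (2 ^ n)) (Fin (2 ^ n)) ℂ)
    (B : κ → Matrix (Fin (2 ^ m)) (Fin (2 ^ m)) ℂ) :
    kron (∑ i ∈ s, A i) (∑ j ∈ t, B j) = ∑ i ∈ s, ∑ j ∈ t, kron (A i) (B j) := by
  simp only [← kronBilin_apply, map_sum, LinearMap.sum_apply]
  exact Finset.sum_comm

/-- The binary digit of `i` of weight `2 ^ t`. -/
def bit (i t : ℕ) : Fin 2 := ⟨i / 2 ^ t % 2, Nat.mod_lt _ two_pos⟩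

theorem bit_div (i m t : ℕ) : bit (i / 2 ^ m) t = bit i (m + t) := by
  simp only [bit, Nat.div_div_eq_div_mul, pow_add]

theorem bit_mod (i : ℕ) {m t : ℕ} (h : t < m) : bit (i % 2 ^ m) t = bit i t := by
  obtain ⟨d, rfl⟩ := Nat.exists_eq_add_of_lt h
  ext
  simp only [bit]
  rw [add_assoc, pow_add, Nat.mod_mul_right_div_self, pow_succ, Nat.mod_mul_left_mod]

theorem pauliTensor_apply (n : ℕ) (f : Fin n → Fin 4) (i j : Fin (2 ^ n)) :
    pauliTensor n f i j = ∏ k : Fin n, pauli (f k) (bit i k.rev) (bit j k.rev) := by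
  induction n with
  | zero =>
    obtain rfl : i = j := Subsingleton.elim (α := Fin 1) i j
    exact one_apply_eq i
  | succ n ih =>
    have hbit (i : Fin (2 ^ (n + 1))) (h : (i : ℕ) / 2 ^ n < 2) :
        (⟨i / 2 ^ n, h⟩ : Fin 2) = bit i n := by
      ext; exact (Nat.mod_eq_of_lt h).symm
    have hlt (i : Fin (2 ^ (n + 1))) : (i : ℕ) / 2 ^ n < 2 :=
      Nat.div_lt_of_lt_mul (by rw [← pow_succ]; exact i.2)
    have key : pauliTensor (n + 1) f i j =
        pauli (f 0) ⟨i / 2 ^ n, hlt i⟩ ⟨j / 2 ^ n, hlt j⟩ *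
        pauliTensor n (fun k => f k.succ) ⟨i % 2 ^ n, Nat.mod_lt _ (by positivity)⟩
          ⟨j % 2 ^ n, Nat.mod_lt _ (by positivity)⟩ := rfl
    rw [key, ih, Fin.prod_univ_succ, hbit, hbit]
    congr 1
    refine Finset.prod_congr rfl fun k _ => ?_
    rw [bit_mod _ k.rev.2, bit_mod _ k.rev.2, Fin.rev_succ, Fin.val_castSucc]

theorem kron_pauliTensor (f : Fin n → Fin 4) (g : Fin m → Fin 4) :
    kron (pauliTensor n f) (pauliTensor m g) = pauliTensor (n + m) (Fin.append f g) := by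
  ext i j
  rw [kron_apply, pauliTensor_apply, pauliTensor_apply, pauliTensor_apply, Fin.prod_univ_add]
  have h₁ (k : Fin n) : ((Fin.castAdd m k).rev : ℕ) = m + k.rev := by
    simp only [Fin.val_rev, Fin.val_castAdd]; omega
  have h₂ (k : Fin m) : ((Fin.natAdd n k).rev : ℕ) = k.rev := by
    simp only [Fin.val_rev, Fin.val_natAdd]; omega
  simp only [Fin.append_left, Fin.append_right, h₁, h₂, kronIndex_fst_val, kronIndex_snd_val,
    bit_div, bit_mod _ (Fin.is_lt _)]

theorem kron_mem_pauliGroup {g : Matrix (Fin (2 ^ n)) (Fin (2 ^ n)) ℂ}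
    {h : Matrix (Fin (2 ^ m)) (Fin (2 ^ m)) ℂ} (hg : g ∈ PauliGroup n) (hh : h ∈ PauliGroup m) :
    kron g h ∈ PauliGroup (n + m) := by
  obtain ⟨k, f, rfl⟩ := hg
  obtain ⟨l, f', rfl⟩ := hh
  refine ⟨k + l, Fin.append f f', ?_⟩
  rw [smul_kron_smul, kron_pauliTensor, ← pow_add, Fin.val_add, ← Complex.I_pow_eq_pow_mod]

theorem pauli_mul_self (k : Fin 4) : pauli k * pauli k = 1 := by
  fin_cases k <;> ext i j <;> fin_cases i <;> fin_cases j <;> simp [pauli, PX, PY, PZ]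

theorem pauliTensor_mul_self (f : Fin n → Fin 4) : pauliTensor n f * pauliTensor n f = 1 := by
  induction n with
  | zero => simp [pauliTensor]
  | succ n ih =>
    simp only [pauliTensor, reindex_apply, submatrix_mul_equiv, ← mul_kronecker_mul,
      pauli_mul_self, ih, one_kronecker_one, submatrix_one_equiv]

theorem IsStabGroup.mul_self {S : Finset (Matrix (Fin (2 ^ n)) (Fin (2 ^ n)) ℂ)}
    (hS : IsStabGroup n S) {g : Matrix (Fin (2 ^ n)) (Fin (2 ^ n)) ℂ} (hg : g ∈ S) :
    g * g = 1 := by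
  obtain ⟨k, f, hk⟩ := hS.1 g hg
  have hsq : g * g = (Complex.I ^ (k : ℕ) * Complex.I ^ (k : ℕ)) •
      (1 : Matrix (Fin (2 ^ n)) (Fin (2 ^ n)) ℂ) := by
    rw [hk, smul_mul_smul_comm, pauliTensor_mul_self]
  have hmem := (hS.2.2.1 g hg g hg).1
  have hneg := hS.2.2.2.2
  rw [← mul_pow, Complex.I_mul_I] at hsq
  obtain h | h := neg_one_pow_eq_or ℂ (k : ℕ)
  · simpa [h] using hsq
  · rw [h, neg_one_smul] at hsq
    exact absurd (hsq ▸ hmem) hneg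

theorem IsStabGroup.eq_one_of_eq_smul {S : Finset (Matrix (Fin (2 ^ n)) (Fin (2 ^ n)) ℂ)}
    (hS : IsStabGroup n S) {g : Matrix (Fin (2 ^ n)) (Fin (2 ^ n)) ℂ} (hg : g ∈ S) {c : ℂ}
    (hc : g = c • (1 : Matrix (Fin (2 ^ n)) (Fin (2 ^ n)) ℂ)) : g = 1 := by
  have h := hS.mul_self hg
  rw [hc, smul_mul_smul_comm, mul_one] at h
  have h00 := congrFun (congrFun h 0) 0
  simp only [Matrix.smul_apply, one_apply_eq, smul_eq_mul, mul_one] at h00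
  obtain rfl | rfl := mul_self_eq_one_iff.1 h00
  · simpa using hc
  · rw [neg_one_smul] at hc
    exact absurd (hc ▸ hg) hS.2.2.2.2

theorem eq_smul_one_of_kron_eq {A : Matrix (Fin (2 ^ n)) (Fin (2 ^ n)) ℂ}
    {B : Matrix (Fin (2 ^ m)) (Fin (2 ^ m)) ℂ} {c : ℂ} (hc : c ≠ 0)
    (h : kron A B = c • (1 : Matrix (Fin (2 ^ (n + m))) (Fin (2 ^ (n + m))) ℂ)) :
    (∃ a : ℂ, A = a • 1) ∧ ∃ b : ℂ, B = b • 1 := by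
  have key (i j : Fin (2 ^ n)) (k l : Fin (2 ^ m)) :
      A i j * B k l = c * ((1 : Matrix _ _ ℂ) i j * (1 : Matrix _ _ ℂ) k l) := by
    rw [← one_kron_one, ← Matrix.ext_iff] at h
    have hijkl := h ((kronIndex n m).symm (i, k)) ((kronIndex n m).symm (j, l))
    rwa [Matrix.smul_apply, kron_apply, kron_apply, Equiv.apply_symm_apply,
      Equiv.apply_symm_apply] at hijkl
  have h0 : A 0 0 * B 0 0 = c := by simpa using key 0 0 0 0
  have hA : A 0 0 ≠ 0 := by rintro h; simp [h] at h0; exact hc h0.symm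
  have hB : B 0 0 ≠ 0 := by rintro h; simp [h] at h0; exact hc h0.symm
  refine ⟨⟨A 0 0, ?_⟩, ⟨B 0 0, ?_⟩⟩
  · ext i j
    refine mul_right_cancel₀ hB ?_
    rw [key i j 0 0, ← h0, Matrix.smul_apply, one_apply_eq, smul_eq_mul]
    ring
  · ext i j
    refine mul_left_cancel₀ hA ?_
    rw [key 0 0 i j, ← h0, Matrix.smul_apply, one_apply_eq, smul_eq_mul]
    ring

theorem IsStabGroup.eq_one_of_kron_eq_one {S : Finset (Matrix (Fin (2 ^ n)) (Fin (2 ^ n)) ℂ)}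
    {T : Finset (Matrix (Fin (2 ^ m)) (Fin (2 ^ m)) ℂ)}
    (hS : IsStabGroup n S) (hT : IsStabGroup m T)
    {g : Matrix (Fin (2 ^ n)) (Fin (2 ^ n)) ℂ} (hg : g ∈ S)
    {h : Matrix (Fin (2 ^ m)) (Fin (2 ^ m)) ℂ} (hh : h ∈ T) {c : ℂ} (hc : c ≠ 0)
    (H : kron g h = c • (1 : Matrix (Fin (2 ^ (n + m))) (Fin (2 ^ (n + m))) ℂ)) :
    g = 1 ∧ h = 1 := by
  obtain ⟨⟨a, ha⟩, ⟨b, hb⟩⟩ := eq_smul_one_of_kron_eq hc H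
  exact ⟨hS.eq_one_of_eq_smul hg ha, hT.eq_one_of_eq_smul hh hb⟩

theorem IsStabGroup.injOn_kron {S : Finset (Matrix (Fin (2 ^ n)) (Fin (2 ^ n)) ℂ)}
    {T : Finset (Matrix (Fin (2 ^ m)) (Fin (2 ^ m)) ℂ)}
    (hS : IsStabGroup n S) (hT : IsStabGroup m T) :
    Set.InjOn (fun p : Matrix (Fin (2 ^ n)) (Fin (2 ^ n)) ℂ ×
      Matrix (Fin (2 ^ m)) (Fin (2 ^ m)) ℂ => kron p.1 p.2) (S ×ˢ T : Finset _) := by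
  rintro ⟨g, h⟩ hp ⟨g', h'⟩ hp' H
  obtain ⟨hg, hh⟩ := Finset.mem_product.1 (Finset.mem_coe.1 hp)
  obtain ⟨hg', hh'⟩ := Finset.mem_product.1 (Finset.mem_coe.1 hp')
  simp only at H hg hh hg' hh'
  have hk : kron (g * g') (h * h') =
      (1 : ℂ) • (1 : Matrix (Fin (2 ^ (n + m))) (Fin (2 ^ (n + m))) ℂ) := by
    rw [← kron_mul_kron, H, kron_mul_kron, hS.mul_self hg', hT.mul_self hh', one_kron_one,
      one_smul]
  obtain ⟨h₁, h₂⟩ := hS.eq_one_of_kron_eq_one hT (hS.2.2.1 g hg g' hg').1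
    (hT.2.2.1 h hh h' hh').1 one_ne_zero hk
  refine Prod.ext ?_ ?_
  · simpa [mul_assoc, hS.mul_self hg'] using congrArg (· * g') h₁
  · simpa [mul_assoc, hT.mul_self hh'] using congrArg (· * h') h₂

open Classical in
theorem IsStabGroup.kron {S : Finset (Matrix (Fin (2 ^ n)) (Fin (2 ^ n)) ℂ)}
    {T : Finset (Matrix (Fin (2 ^ m)) (Fin (2 ^ m)) ℂ)}
    (hS : IsStabGroup n S) (hT : IsStabGroup m T) :
    IsStabGroup (n + m) ((S ×ˢ T).image fun p => _root_.kron p.1 p.2) := by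
  refine ⟨?_, ?_, ?_, ?_, ?_⟩
  · simp only [Finset.mem_image, Finset.mem_product]
    rintro _ ⟨⟨g, h⟩, ⟨hg, hh⟩, rfl⟩
    exact kron_mem_pauliGroup (hS.1 g hg) (hT.1 h hh)
  · exact Finset.mem_image.2 ⟨(1, 1), Finset.mem_product.2 ⟨hS.2.1, hT.2.1⟩, one_kron_one⟩
  · simp only [Finset.mem_image, Finset.mem_product]
    rintro _ ⟨⟨g, h⟩, ⟨hg, hh⟩, rfl⟩ _ ⟨⟨g', h'⟩, ⟨hg', hh'⟩, rfl⟩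
    obtain ⟨hgg, hgc⟩ := hS.2.2.1 g hg g' hg'
    obtain ⟨hhh, hhc⟩ := hT.2.2.1 h hh h' hh'
    refine ⟨⟨(g * g', h * h'), ⟨hgg, hhh⟩, (kron_mul_kron _ _ _ _).symm⟩, ?_⟩
    rw [kron_mul_kron, kron_mul_kron, hgc, hhc]
  · rw [Finset.card_image_of_injOn (hS.injOn_kron hT), Finset.card_product, hS.2.2.2.1,
      hT.2.2.2.1, pow_add]
  · simp only [Finset.mem_image, Finset.mem_product, not_exists, not_and]
    rintro ⟨g, h⟩ ⟨hg, hh⟩ H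
    obtain ⟨rfl, rfl⟩ := hS.eq_one_of_kron_eq_one hT hg hh (c := -1) (by norm_num)
      (by rw [neg_one_smul]; exact H)
    have h00 := congrFun (congrFun H 0) 0
    norm_num [one_kron_one] at h00

theorem kron_mem_stab {s : Matrix (Fin (2 ^ n)) (Fin (2 ^ n)) ℂ}
    {t : Matrix (Fin (2 ^ m)) (Fin (2 ^ m)) ℂ} (hs : s ∈ Stab n) (ht : t ∈ Stab m) :
    kron s t ∈ Stab (n + m) := by
  classical
  obtain ⟨S, hS, rfl⟩ := hs
  obtain ⟨T, hT, rfl⟩ := ht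
  refine ⟨_, hS.kron hT, ?_⟩
  rw [Finset.sum_image (hS.injOn_kron hT), Finset.sum_product, smul_kron_smul, sum_kron_sum,
    ← mul_inv, ← pow_add]

theorem kron_mem_span_stab {A : Matrix (Fin (2 ^ n)) (Fin (2 ^ n)) ℂ}
    {B : Matrix (Fin (2 ^ m)) (Fin (2 ^ m)) ℂ}
    (hA : A ∈ Submodule.span ℝ (Stab n)) (hB : B ∈ Submodule.span ℝ (Stab m)) :
    kron A B ∈ Submodule.span ℝ (Stab (n + m)) := by
  have h := Submodule.apply_mem_map₂ (kronBilin n m) hA hB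
  rw [Submodule.map₂_span_span] at h
  refine Submodule.span_mono ?_ h
  rintro _ ⟨s, hs, t, ht, rfl⟩
  exact kron_mem_stab hs ht

/-- The Pauli matrix `pauli k` as a one-qubit operator. -/
def singlePauli (k : Fin 4) : Matrix (Fin (2 ^ 1)) (Fin (2 ^ 1)) ℂ := pauliTensor 1 fun _ => k

theorem singlePauli_apply (k : Fin 4) (i j : Fin 2) : singlePauli k i j = pauli k i j := by
  rw [singlePauli, pauliTensor_apply]
  fin_cases i <;> fin_cases j <;> simp [bit]

theorem singlePauli_zero : singlePauli 0 = 1 := by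
  ext i j
  exact singlePauli_apply 0 i j

theorem singlePauli_ne_smul_one {k : Fin 4} (hk : k ≠ 0) (c : ℂ) :
    singlePauli k ≠ c • (1 : Matrix (Fin (2 ^ 1)) (Fin (2 ^ 1)) ℂ) := by
  intro h
  have H (i j : Fin 2) : pauli k i j = c * (1 : Matrix (Fin 2) (Fin 2) ℂ) i j := by
    rw [← singlePauli_apply, h]; rfl
  have h01 := H 0 1
  have h00 := H 0 0
  have h11 := H 1 1
  fin_cases k
  · exact hk rfl
  · simp [pauli, PX] at h01
  · simp [pauli, PY] at h01
  · simp [pauli, PZ] at h00 h11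
    rw [← h00] at h11
    norm_num at h11

theorem smul_one_add_singlePauli_mem_stab {k : Fin 4} (hk : k ≠ 0) {e : Fin 4} {c : ℂ}
    (he : Complex.I ^ (e : ℕ) = c) (hc : c * c = 1) :
    (2 : ℂ)⁻¹ • (1 + c • singlePauli k) ∈ Stab 1 := by
  classical
  have hne (a : ℂ) : c • singlePauli k ≠ a • 1 := by
    intro h
    refine singlePauli_ne_smul_one hk (c * a) ?_
    rw [mul_smul, ← h, smul_smul, hc, one_smul]
  have hne1 : 1 ≠ c • singlePauli k := fun h => hne 1 (by rw [one_smul]; exact h.symm)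
  have hsq : c • singlePauli k * c • singlePauli k = 1 := by
    rw [smul_mul_smul_comm, hc, one_smul]; exact pauliTensor_mul_self _
  refine ⟨{1, c • singlePauli k}, ⟨?_, ?_, ?_, ?_, ?_⟩, ?_⟩
  · simp only [Finset.mem_insert, Finset.mem_singleton]
    rintro g (rfl | rfl)
    · exact ⟨0, fun _ => 0, by rw [Fin.val_zero, pow_zero, one_smul]; exact singlePauli_zero.symm⟩
    · exact ⟨e, fun _ => k, by rw [he]; rfl⟩
  · simp
  · simp only [Finset.mem_insert, Finset.mem_singleton]
    rintro g (rfl | rfl) h (rfl | rfl) <;> simp only [hsq, one_mul, mul_one, true_or, or_true,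
      and_self]
  · rw [Finset.card_pair hne1, pow_one]
  · simp only [Finset.mem_insert, Finset.mem_singleton, not_or]
    refine ⟨fun h => ?_, fun h => hne (-1) (by rw [neg_one_smul]; exact h.symm)⟩
    have h00 := congrFun (congrFun h 0) 0
    norm_num at h00
  · rw [Finset.sum_pair hne1, pow_one (2 : ℂ)]

theorem singlePauli_mem_span_stab (k : Fin 4) :
    singlePauli k ∈ Submodule.span ℝ (Stab 1) := by
  have hp {k : Fin 4} (hk : k ≠ 0) := Submodule.subset_span (R := ℝ)
    (smul_one_add_singlePauli_mem_stab hk (e := 0) (c := 1) (by simp) (by simp))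
  have hm {k : Fin 4} (hk : k ≠ 0) := Submodule.subset_span (R := ℝ)
    (smul_one_add_singlePauli_mem_stab hk (e := 2) (c := -1) (by simp) (by simp))
  by_cases hk : k = 0
  · subst hk
    rw [singlePauli_zero]
    convert add_mem (hp (k := 1) (by decide)) (hm (k := 1) (by decide)) using 1
    module
  · convert sub_mem (hp hk) (hm hk) using 1
    module

/-- The coefficient of `pauli k` in the Pauli expansion of a matrix in its first qubit. -/
def pauliBlock (M : Matrix (Fin (2 ^ (1 + n))) (Fin (2 ^ (1 + n))) ℂ) (k : Fin 4) :
    Matrix (Fin (2 ^ n)) (Fin (2 ^ n)) ℂ :=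
  Matrix.of fun i j => (1 / 2 : ℂ) * ∑ p : Fin 2, ∑ q : Fin 2, pauli k q p *
    M ((kronIndex 1 n).symm (p, i)) ((kronIndex 1 n).symm (q, j))

theorem pauli_isHermitian (k : Fin 4) : (pauli k).IsHermitian := by
  fin_cases k <;> ext i j <;> fin_cases i <;> fin_cases j <;> simp [pauli, PX, PY, PZ]

theorem isHermitian_pauliBlock {M : Matrix (Fin (2 ^ (1 + n))) (Fin (2 ^ (1 + n))) ℂ}
    (hM : M.IsHermitian) (k : Fin 4) : (pauliBlock M k).IsHermitian := by
  ext i j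
  simp only [pauliBlock, conjTranspose_apply, of_apply, star_mul', star_sum, hM.apply,
    (pauli_isHermitian k).apply]
  rw [Finset.sum_comm]
  simp

theorem sum_singlePauli_kron_pauliBlock
    (M : Matrix (Fin (2 ^ (1 + n))) (Fin (2 ^ (1 + n))) ℂ) :
    ∑ k, kron (singlePauli k) (pauliBlock M k) = M := by
  ext i j
  obtain ⟨⟨p, i⟩, rfl⟩ := (kronIndex 1 n).symm.surjective i
  obtain ⟨⟨q, j⟩, rfl⟩ := (kronIndex 1 n).symm.surjective j
  simp only [Matrix.sum_apply, kron_apply, Equiv.apply_symm_apply]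
  change Fin 2 at p q
  simp only [singlePauli_apply, pauliBlock, of_apply, Fin.sum_univ_four, Fin.sum_univ_two]
  fin_cases p <;> fin_cases q <;> simp [pauli, PX, PY, PZ] <;> ring_nf <;> simp <;> ring

theorem mem_span_stab_of_isHermitian (n : ℕ) :
    ∀ M : Matrix (Fin (2 ^ n)) (Fin (2 ^ n)) ℂ, M.IsHermitian →
      M ∈ Submodule.span ℝ (Stab n) := by
  induction n with
  | zero =>
    intro M hM
    have h1 : (1 : Matrix (Fin (2 ^ 0)) (Fin (2 ^ 0)) ℂ) ∈ Stab 0 := by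
      refine ⟨{1}, ⟨?_, ?_, ?_, ?_, ?_⟩, ?_⟩
      · intro g hg
        exact ⟨0, Fin.elim0, by simpa [pauliTensor] using hg⟩
      · simp
      · simp
      · simp
      · intro h
        have h00 := congrFun (congrFun (Finset.mem_singleton.1 h) 0) 0
        norm_num at h00
      · simp
    have hM' : M = (M 0 0).re • (1 : Matrix (Fin (2 ^ 0)) (Fin (2 ^ 0)) ℂ) := by
      ext i j
      obtain rfl : i = 0 := Subsingleton.elim (α := Fin 1) i 0
      obtain rfl : j = 0 := Subsingleton.elim (α := Fin 1) j 0
      simpa using (hM.coe_re_apply_self 0).symm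
    rw [hM']
    exact Submodule.smul_mem _ _ (Submodule.subset_span h1)
  | succ n ih =>
    rw [add_comm n 1]
    intro M hM
    rw [← sum_singlePauli_kron_pauliBlock M]
    exact sum_mem fun k _ => kron_mem_span_stab (singlePauli_mem_span_stab k)
      (ih _ (isHermitian_pauliBlock hM k))

/-- The costs of the stabilizer decompositions of `ρ`. -/
def decompCosts (n : ℕ) (ρ : Matrix (Fin (2 ^ n)) (Fin (2 ^ n)) ℂ) : Set ℝ :=
  { t | ∃ (k : ℕ) (a : Fin k → ℝ) (s : Fin k → Matrix (Fin (2 ^ n)) (Fin (2 ^ n)) ℂ),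
      (∀ i, s i ∈ Stab n) ∧ ρ = ∑ i, a i • s i ∧ t = ∑ i, |a i| }

theorem decompCosts_nonempty {ρ : Matrix (Fin (2 ^ n)) (Fin (2 ^ n)) ℂ} (hρ : ρ.IsHermitian) :
    (decompCosts n ρ).Nonempty := by
  obtain ⟨k, a, s, h⟩ := Submodule.mem_span_set'.1 (mem_span_stab_of_isHermitian n ρ hρ)
  exact ⟨_, k, a, fun i => s i, fun i => (s i).2, h.symm, rfl⟩

theorem nonneg_of_mem_decompCosts {ρ : Matrix (Fin (2 ^ n)) (Fin (2 ^ n)) ℂ} {t : ℝ}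
    (ht : t ∈ decompCosts n ρ) : 0 ≤ t := by
  obtain ⟨k, a, s, -, -, rfl⟩ := ht
  positivity

theorem mul_mem_decompCosts {ρ : Matrix (Fin (2 ^ n)) (Fin (2 ^ n)) ℂ}
    {σ : Matrix (Fin (2 ^ m)) (Fin (2 ^ m)) ℂ} {x y : ℝ}
    (hx : x ∈ decompCosts n ρ) (hy : y ∈ decompCosts m σ) :
    x * y ∈ decompCosts (n + m) (kron ρ σ) := by
  obtain ⟨k, a, s, hs, rfl, rfl⟩ := hx
  obtain ⟨l, b, t, ht, rfl, rfl⟩ := hy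
  refine ⟨k * l, fun i => a (finProdFinEquiv.symm i).1 * b (finProdFinEquiv.symm i).2,
    fun i => kron (s (finProdFinEquiv.symm i).1) (t (finProdFinEquiv.symm i).2),
    fun i => kron_mem_stab (hs _) (ht _), ?_, ?_⟩
  · rw [finProdFinEquiv.symm.sum_comp (fun p : Fin k × Fin l => (a p.1 * b p.2) •
      kron (s p.1) (t p.2)), Fintype.sum_prod_type, sum_kron_sum]
    simp only [← kronBilin_apply, map_smul, LinearMap.smul_apply, smul_smul, mul_comm]
  · rw [finProdFinEquiv.symm.sum_comp (fun p : Fin k × Fin l => |a p.1 * b p.2|),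
      Fintype.sum_prod_type, Finset.sum_mul_sum]
    simp only [abs_mul]

end

/-- submultiplicativity of the stabilizer extent under Kronecker products. -/
theorem gam_kron_le (n m : ℕ) (hn : 1 ≤ n) (hm : 1 ≤ m)
    (ρ : Matrix (Fin (2 ^ n)) (Fin (2 ^ n)) ℂ)
    (σ : Matrix (Fin (2 ^ m)) (Fin (2 ^ m)) ℂ)
    (hρ : IsDensity ρ) (hσ : IsDensity σ) :
    Gam (n + m) (kron ρ σ) ≤ Gam n ρ * Gam m σ := by
  refine le_mul_of_forall_lt₀ fun x hx y hy => ?_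
  obtain ⟨u, hu, hux⟩ := exists_lt_of_csInf_lt (decompCosts_nonempty hρ.1.1) hx
  obtain ⟨v, hv, hvy⟩ := exists_lt_of_csInf_lt (decompCosts_nonempty hσ.1.1) hy
  calc Gam (n + m) (kron ρ σ) ≤ u * v :=
        csInf_le ⟨0, fun _ => nonneg_of_mem_decompCosts⟩ (mul_mem_decompCosts hu hv)
    _ ≤ x * y := mul_le_mul hux.le hvy.le (nonneg_of_mem_decompCosts hv)
        ((nonneg_of_mem_decompCosts hu).trans hux.le)
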